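/- arXiv:2506.17507 — 4 statements merged into one kernel-verified Lean document; each statement's English description precedes it below -/
import Mathlib

section
/- Let S be a finite set of points in the plane ℝ² and let p, q, r ∈ S. Suppose the triple (q, p, r) makes a strict clockwise turn, i.e. det(p − q, r − p) < 0, and suppose every point s ∈ S satisfies both det(r − p, s − p) ≤ 0 (s lies weakly right of the directed line from p through r) and det(q − p, s − p) ≥ 0 (s lies weakly left of the directed line from p through q). Then p does not belong to the convex hull of S \ {p}; in particular, p is a vertex (extreme point) of the convex hull of S. (This is the core geometric content of the paper's Lemma 2: a point all of whose fellow points lie in the salient closed cone at p between the rays toward q and r must be a hull vertex.) -/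
/-- det of two planar vectors. -/
def det2 (a b : ℝ × ℝ) : ℝ := a.1 * b.2 - a.2 * b.1

/-- A vector with vanishing `det2` against two linearly independent vectors is zero. -/
lemma eq_zero_of_det2_eq_zero {u v w : ℝ × ℝ} (huv : det2 u v ≠ 0)
    (hu : det2 u w = 0) (hv : det2 v w = 0) : w = 0 := by
  unfold det2 at *
  have h₁ : (u.1 * v.2 - u.2 * v.1) * w.1 = 0 := by linear_combination v.1 * hu - u.1 * hv
  have h₂ : (u.1 * v.2 - u.2 * v.1) * w.2 = 0 := by linear_combination v.2 * hu - u.2 * hv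
  exact Prod.ext ((mul_eq_zero.mp h₁).resolve_left huv) ((mul_eq_zero.mp h₂).resolve_left huv)

/-- The open half-plane to the left of the line through `p` with direction `a` is convex. -/
lemma convex_setOf_det2_sub_pos (a p : ℝ × ℝ) : Convex ℝ {s | 0 < det2 a (s - p)} := by
  intro x hx y hy α β hα hβ hαβ
  have key : det2 a (α • x + β • y - p) = α * det2 a (x - p) + β * det2 a (y - p) := by
    simp only [det2, Prod.fst_sub, Prod.snd_sub, Prod.fst_add, Prod.snd_add, Prod.smul_fst,
      Prod.smul_snd, smul_eq_mul]
    linear_combination (a.1 * p.2 - a.2 * p.1) * hαβ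
  rw [Set.mem_ofPred_eq, key]
  exact convex_Ioi (0 : ℝ) hx hy hα hβ hαβ

/-- if every point of `S` lies weakly right of the directed line from `p`
through `r` and weakly left of the directed line from `p` through `q`, and `(q, p, r)`
makes a strict clockwise turn, then `p` is not in the convex hull of `S \ {p}`. -/
theorem stmt0 (S : Finset (ℝ × ℝ)) (p q r : ℝ × ℝ)
    (hp : p ∈ S) (hq : q ∈ S) (hr : r ∈ S)
    (hturn : det2 (p - q) (r - p) < 0)
    (hright : ∀ s ∈ S, det2 (r - p) (s - p) ≤ 0)
    (hleft : ∀ s ∈ S, det2 (q - p) (s - p) ≥ 0) :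
    p ∉ convexHull ℝ ((S : Set (ℝ × ℝ)) \ {p}) := by
  have hqr : det2 (q - p) (r - p) ≠ 0 := by
    have : det2 (q - p) (r - p) = -det2 (p - q) (r - p) := by
      simp only [det2, Prod.fst_sub, Prod.snd_sub]
      ring
    linarith
  intro hmem
  have hsub : (S : Set (ℝ × ℝ)) \ {p} ⊆ {s | 0 < det2 (q - r) (s - p)} := by
    rintro s ⟨hs, hsp⟩
    have hsplit : det2 (q - r) (s - p) = det2 (q - p) (s - p) - det2 (r - p) (s - p) := by
      simp only [det2, Prod.fst_sub, Prod.snd_sub]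
      ring
    have h₁ := hright s hs
    have h₂ := hleft s hs
    by_contra hneg
    rw [Set.mem_ofPred_eq, hsplit] at hneg
    exact hsp (sub_eq_zero.mp
      (eq_zero_of_det2_eq_zero hqr (by linarith) (by linarith)))
  have hpos := convexHull_min hsub (convex_setOf_det2_sub_pos (q - r) p) hmem
  simp [det2] at hpos
end

section
/- Let S be a finite set of points in the plane ℝ² and let p, q, r ∈ S with q₁ < p₁ < r₁ and det(p − q, r − p) < 0 (the triple (q, p, r) makes a strict clockwise turn). Suppose every point s ∈ S with s₁ ≤ p₁ satisfies det(q − p, s − p) ≥ 0 (no point weakly left of the vertical line through p lies strictly right of the directed line from p through q), and every point s ∈ S with s₁ ≥ p₁ satisfies det(r − p, s − p) ≤ 0 (no point weakly right of the vertical line through p lies strictly left of the directed line from p through r). Then p does not belong to the convex hull of S \ {p}. (This is the paper's Lemma 2 with q and r playing the roles of the counterclockwise and clockwise angular neighbors of p defined by a vertical reference line.) -/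
/-- If `p` lies strictly between `q` and `r` horizontally and `(q, p, r)` turns clockwise, then a
point `s ≠ p` satisfying the two one-sided half-plane conditions lies strictly right of the line
through `p` in direction `r - q`. -/
theorem det2_sub_neg_of_clockwise {p q r s : ℝ × ℝ} (hqp : q.1 < p.1) (hpr : p.1 < r.1)
    (hturn : det2 (p - q) (r - p) < 0)
    (hleft : s.1 ≤ p.1 → det2 (q - p) (s - p) ≥ 0)
    (hright : s.1 ≥ p.1 → det2 (r - p) (s - p) ≤ 0) (hs : s ≠ p) :
    det2 (r - q) (s - p) < 0 := by
  obtain ⟨p₁, p₂⟩ := p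
  obtain ⟨q₁, q₂⟩ := q
  obtain ⟨r₁, r₂⟩ := r
  obtain ⟨s₁, s₂⟩ := s
  simp only [det2, Prod.mk_sub_mk, ne_eq, Prod.mk.injEq] at *
  rcases lt_trichotomy s₁ p₁ with h | rfl | h
  · have hl := hleft h.le
    by_contra! hc
    nlinarith [mul_nonneg (sub_nonneg.2 hqp.le) hc,
      mul_nonneg (sub_nonneg.2 (hqp.trans hpr).le) hl,
      mul_pos_of_neg_of_neg hturn (sub_neg.2 h)]
  · have hl := hleft le_rfl
    have hle : s₂ ≤ p₂ := by
      by_contra! hc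
      nlinarith [mul_pos (sub_pos.2 hqp) (sub_pos.2 hc)]
    have hlt : s₂ < p₂ := lt_of_le_of_ne hle fun h => hs ⟨rfl, h⟩
    nlinarith [mul_pos (sub_pos.2 (hqp.trans hpr)) (sub_pos.2 hlt)]
  · have hl := hright h.le
    by_contra! hc
    nlinarith [mul_nonneg (sub_nonneg.2 hpr.le) hc,
      mul_nonneg (sub_nonneg.2 (hqp.trans hpr).le) (neg_nonneg.2 hl),
      mul_pos (neg_pos.2 hturn) (sub_pos.2 h)]

/-- The open half-plane strictly right of a directed line is convex. -/
theorem convex_setOf_det2_sub_neg (v p : ℝ × ℝ) : Convex ℝ {s | det2 v (s - p) < 0} := by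
  have hlin : IsLinearMap ℝ (det2 v) :=
    ⟨fun x y => by simp only [det2, Prod.fst_add, Prod.snd_add]; ring,
      fun c x => by simp only [det2, Prod.smul_fst, Prod.smul_snd, smul_eq_mul]; ring⟩
  simp only [hlin.map_sub, sub_neg]
  exact convex_halfSpace_lt hlin (det2 v p)

/-- the paper's Lemma 2, with the two half-plane conditions restricted to the
two sides of the vertical line through `p`. -/
theorem stmt1 (S : Finset (ℝ × ℝ)) (p q r : ℝ × ℝ)
    (hp : p ∈ S) (hq : q ∈ S) (hr : r ∈ S)
    (hx : q.1 < p.1 ∧ p.1 < r.1)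
    (hturn : det2 (p - q) (r - p) < 0)
    (hleft : ∀ s ∈ S, s.1 ≤ p.1 → det2 (q - p) (s - p) ≥ 0)
    (hright : ∀ s ∈ S, s.1 ≥ p.1 → det2 (r - p) (s - p) ≤ 0) :
    p ∉ convexHull ℝ ((S : Set (ℝ × ℝ)) \ {p}) := by
  intro hmem
  have hsub : (S : Set (ℝ × ℝ)) \ {p} ⊆ {s | det2 (r - q) (s - p) < 0} := fun s hs =>
    det2_sub_neg_of_clockwise hx.1 hx.2 hturn (hleft s hs.1) (hright s hs.1) hs.2
  have hneg := convexHull_min hsub (convex_setOf_det2_sub_neg (r - q) p) hmem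
  simp [det2] at hneg
end

section
/- Let p, q, r ∈ ℝ² with q₁ < p₁ < r₁ and det(p − q, r − p) < 0 (the triple (q, p, r) makes a strict clockwise turn). Then: (a) every point s ∈ ℝ² with s₁ ≤ p₁ and det(q − p, s − p) ≥ 0 also satisfies det(r − p, s − p) ≤ 0; and (b) every point s ∈ ℝ² with s₁ ≥ p₁ and det(r − p, s − p) ≤ 0 also satisfies det(q − p, s − p) ≥ 0. (This is the step in the proof of Lemma 2 asserting that, because the two forbidden regions border each other along the vertical line through p and (q, p, r) is a right-hand turn, the union of the two vertically-restricted half-plane conditions equals the full two-half-plane cone condition.) -/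
/-- for a strict clockwise turn `(q, p, r)` with `q₁ < p₁ < r₁`, each
vertically-restricted half-plane condition implies the other half-plane condition. -/
theorem stmt2 (p q r : ℝ × ℝ)
    (hx : q.1 < p.1 ∧ p.1 < r.1)
    (hturn : det2 (p - q) (r - p) < 0) :
    (∀ s : ℝ × ℝ, s.1 ≤ p.1 → det2 (q - p) (s - p) ≥ 0 → det2 (r - p) (s - p) ≤ 0) ∧
    (∀ s : ℝ × ℝ, s.1 ≥ p.1 → det2 (r - p) (s - p) ≤ 0 → det2 (q - p) (s - p) ≥ 0) := by
  obtain ⟨hq, hr⟩ := hx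
  have hu : 0 < p.1 - q.1 := sub_pos.2 hq
  have hv : 0 < r.1 - p.1 := sub_pos.2 hr
  have key (s : ℝ × ℝ) : (p.1 - q.1) * det2 (r - p) (s - p) =
      -((r.1 - p.1) * det2 (q - p) (s - p)) - (s.1 - p.1) * det2 (p - q) (r - p) := by
    simp only [det2, Prod.fst_sub, Prod.snd_sub]
    ring
  refine ⟨fun s hs h => ?_, fun s hs h => ?_⟩
  · have h₁ := mul_nonneg hv.le h
    have h₂ := mul_nonneg_of_nonpos_of_nonpos (sub_nonpos.2 hs) hturn.le
    exact nonpos_of_mul_nonpos_right (by linarith [key s]) hu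
  · have h₁ := mul_nonpos_of_nonneg_of_nonpos hu.le h
    have h₂ := mul_nonpos_of_nonneg_of_nonpos (sub_nonneg.2 hs) hturn.le
    exact nonneg_of_mul_nonneg_right (by linarith [key s]) hv
end

section
/- Let c ≥ 0 be a real number and let g : ℝ → ℝ satisfy: (i) g(x) ≤ c·x for all x with 2 ≤ x ≤ 4, and (ii) g(x) ≤ √x · g(√x) + c·x·log x for all x > 4. Then g(x) ≤ 2c·x·log x + c·x for all x ≥ 2. (This solves the work recurrence W(n) = √n · W(√n) + O(n log n) used in the analysis of the 2D convex hull algorithm, Theorem 7, showing W(n) = O(n log n) via a geometric series.) -/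
/-- solution of the work recurrence `W(n) = √n · W(√n) + O(n log n)`. -/
theorem stmt7 (c : ℝ) (hc : 0 ≤ c) (g : ℝ → ℝ)
    (hbase : ∀ x : ℝ, 2 ≤ x → x ≤ 4 → g x ≤ c * x)
    (hrec : ∀ x : ℝ, 4 < x → g x ≤ Real.sqrt x * g (Real.sqrt x) + c * x * Real.log x) :
    ∀ x : ℝ, 2 ≤ x → g x ≤ 2 * c * x * Real.log x + c * x := by
  have small : ∀ x : ℝ, 2 ≤ x → x ≤ 4 → g x ≤ 2 * c * x * Real.log x + c * x := by
    intro x h2 h4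
    have hlog : 0 ≤ Real.log x := Real.log_nonneg (by linarith)
    have hnonneg : 0 ≤ 2 * c * x * Real.log x := by positivity
    linarith [hbase x h2 h4]
  have bounded : ∀ n : ℕ, ∀ x : ℝ, 2 ≤ x → x ≤ 4 + n →
      g x ≤ 2 * c * x * Real.log x + c * x := by
    intro n
    induction n with
    | zero => exact fun x h2 hx => small x h2 (by simpa using hx)
    | succ k ih =>
      intro x h2 hx
      rcases le_or_gt x 4 with h4 | h4
      · exact small x h2 h4
      push_cast at hx
      have hsq : √x * √x = x := Real.mul_self_sqrt (by linarith)
      have hs2 : 2 ≤ √x := Real.le_sqrt_of_sq_le (by linarith)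
      have hsk : √x ≤ 4 + k := by nlinarith
      have hlog : Real.log √x = Real.log x / 2 := Real.log_sqrt (by linarith)
      calc g x ≤ √x * g √x + c * x * Real.log x := hrec x h4
        _ ≤ √x * (2 * c * √x * Real.log √x + c * √x) + c * x * Real.log x := by
          gcongr
          exact ih _ hs2 hsk
        _ = (√x * √x) * (c * Real.log x + c) + c * x * Real.log x := by
          rw [hlog]
          ring
        _ = 2 * c * x * Real.log x + c * x := by
          rw [hsq]
          ring
  intro x h2
  obtain ⟨n, hn⟩ := exists_nat_ge x
  exact bounded n x h2 (by linarith)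
end
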